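/- arXiv:1305.6674 — 4 statements merged into one kernel-verified Lean document; each statement's English description precedes it below -/
import Mathlib

section
/- Let C := {[θ⁻(e)τ] : e ∈ K} ∪ {[τ]} ⊆ ℙ_K(L), a nondegenerate conic of q+1 points. Set C_e := [θ⁻(e)τ] and T_e := [θ⁻(e)²τ] for e ∈ K, and C_∞ := [τ], T_∞ := [τ²]. Then for each e ∈ K ∪ {∞}, the points C_e and T_e are distinct, T_e ∉ C, and the line of ℙ_K(L) through C_e and T_e meets C only in the point C_e; that is, the line C_eT_e is the tangent line to the conic C at C_e. -/
open scoped LinearAlgebra.Projectivization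
open Module

noncomputable section

/-- Evaluation of the quadratic form with coefficient vector `c`
(coefficients of y₀², y₁², y₂², y₀y₁, y₀y₂, y₁y₂) at coordinates `y` in a `K`-algebra `A`. -/
def conicEval (K A : Type*) [CommSemiring K] [CommSemiring A] [Algebra K A]
    (c : Fin 6 → K) (y : Fin 3 → A) : A :=
  algebraMap K A (c 0) * (y 0 * y 0) + algebraMap K A (c 1) * (y 1 * y 1) +
    algebraMap K A (c 2) * (y 2 * y 2) + algebraMap K A (c 3) * (y 0 * y 1) +
    algebraMap K A (c 4) * (y 0 * y 2) + algebraMap K A (c 5) * (y 1 * y 2)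

/-- The zero set in ℙ_K(L) of the quadratic form `c`, in the coordinates (y₀,y₁,y₂) given by
the basis `B` (so λ = y₀·B 0 + y₁·B 1 + y₂·B 2, i.e. λ = y₀ + y₁τ + y₂τ²). -/
def conicZeroSet (K L : Type*) [Field K] [Field L] [Algebra K L]
    (B : Basis (Fin 3) K L) (c : Fin 6 → K) : Set (ℙ K L) :=
  {P | conicEval K K c (fun i => B.repr P.rep i) = 0}

/-- No three of the points of `Z` are collinear in ℙ_K(L). -/
def NoThreeCollinear (K L : Type*) [Field K] [Field L] [Algebra K L]
    (Z : Set (ℙ K L)) : Prop :=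
  ∀ P₁ P₂ P₃ : ℙ K L, P₁ ∈ Z → P₂ ∈ Z → P₃ ∈ Z → P₁ ≠ P₂ → P₁ ≠ P₃ → P₂ ≠ P₃ →
    ∀ W : Submodule K L, Module.finrank K W = 2 →
      ¬(P₁.submodule ≤ W ∧ P₂.submodule ≤ W ∧ P₃.submodule ≤ W)

/-- The quadratic form `c`, evaluated over `L`, vanishes at the transversal vector
R = (t₁+t₂τ−τ², t₂−τ, −1). -/
def RvanishL (K L : Type*) [Field K] [Field L] [Algebra K L] (τ : L) (t₀ t₁ t₂ : K)
    (c : Fin 6 → K) : Prop :=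
  conicEval K L c
    ![algebraMap K L t₁ + algebraMap K L t₂ * τ - τ ^ 2, algebraMap K L t₂ - τ, -1] = 0

/-- A special conic of ℙ_K(L): the zero set of a quadratic form over K which is a
nondegenerate conic (q+1 points, no three collinear) and whose form, evaluated over L,
vanishes at the transversal vector R. -/
def IsSpecialConic (q : ℕ) (K L : Type*) [Field K] [Field L] [Algebra K L]
    (B : Basis (Fin 3) K L) (τ : L) (t₀ t₁ t₂ : K) (Z : Set (ℙ K L)) : Prop :=
  ∃ c : Fin 6 → K, Z = conicZeroSet K L B c ∧ Z.ncard = q + 1 ∧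
    NoThreeCollinear K L Z ∧ RvanishL K L τ t₀ t₁ t₂ c

/-- The three-conic-points relation. -/
theorem aux_three {K L : Type} [Field K] [Field L] [Algebra K L] (τ : L) (hτ : τ ≠ 0)
    (hind : ∀ a b c : K, algebraMap K L a + algebraMap K L b * τ + algebraMap K L c * τ ^ 2 = 0 →
      a = 0 ∧ b = 0 ∧ c = 0)
    (e₁ s₁ e₂ s₂ e₃ s₃ k₁ k₂ k₃ α β γ : K) (C₁ C₂ C₃ : L)
    (h₁ : C₁ * (algebraMap K L e₁ + algebraMap K L s₁ * τ) = algebraMap K L k₁ * τ)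
    (h₂ : C₂ * (algebraMap K L e₂ + algebraMap K L s₂ * τ) = algebraMap K L k₂ * τ)
    (h₃ : C₃ * (algebraMap K L e₃ + algebraMap K L s₃ * τ) = algebraMap K L k₃ * τ)
    (hk₁ : k₁ ≠ 0)
    (d₂ : e₂ * s₁ - s₂ * e₁ ≠ 0) (d₃ : e₃ * s₁ - s₃ * e₁ ≠ 0)
    (h : α • C₁ + β • C₂ + γ • C₃ = 0) : α = 0 := by
  simp only [Algebra.smul_def] at h
  have key : algebraMap K L (α * k₁ * (e₂ * e₃) + β * k₂ * (e₁ * e₃) + γ * k₃ * (e₁ * e₂))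
      + algebraMap K L (α * k₁ * (e₂ * s₃ + s₂ * e₃) + β * k₂ * (e₁ * s₃ + s₁ * e₃)
        + γ * k₃ * (e₁ * s₂ + s₁ * e₂)) * τ
      + algebraMap K L (α * k₁ * (s₂ * s₃) + β * k₂ * (s₁ * s₃) + γ * k₃ * (s₁ * s₂)) * τ ^ 2
      = 0 := by
    apply mul_right_cancel₀ hτ
    simp only [map_add, map_mul]
    set f := algebraMap K L
    linear_combination (f e₁ + f s₁ * τ) * (f e₂ + f s₂ * τ) * (f e₃ + f s₃ * τ) * h
      - f α * (f e₂ + f s₂ * τ) * (f e₃ + f s₃ * τ) * h₁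
      - f β * (f e₁ + f s₁ * τ) * (f e₃ + f s₃ * τ) * h₂
      - f γ * (f e₁ + f s₁ * τ) * (f e₂ + f s₂ * τ) * h₃
  obtain ⟨a, b, c⟩ := hind _ _ _ key
  have : α * (k₁ * (e₂ * s₁ - s₂ * e₁) * (e₃ * s₁ - s₃ * e₁)) = 0 := by
    linear_combination s₁ ^ 2 * a - s₁ * e₁ * b + e₁ ^ 2 * c
  exact (mul_eq_zero.1 this).resolve_right (mul_ne_zero (mul_ne_zero hk₁ d₂) d₃)

/-- The tangent relation. -/
theorem aux_tan {K L : Type} [Field K] [Field L] [Algebra K L] (τ : L) (hτ : τ ≠ 0)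
    (hind : ∀ a b c : K, algebraMap K L a + algebraMap K L b * τ + algebraMap K L c * τ ^ 2 = 0 →
      a = 0 ∧ b = 0 ∧ c = 0)
    (e₁ s₁ e₂ s₂ a₁ b₁ k₁ k₂ m₁ α β γ : K) (C₁ C₂ T₁ : L)
    (h₁ : C₁ * (algebraMap K L e₁ + algebraMap K L s₁ * τ) = algebraMap K L k₁ * τ)
    (h₂ : C₂ * (algebraMap K L e₂ + algebraMap K L s₂ * τ) = algebraMap K L k₂ * τ)
    (h₃ : T₁ * (algebraMap K L e₁ + algebraMap K L s₁ * τ) ^ 2 =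
      algebraMap K L m₁ * τ * (algebraMap K L a₁ + algebraMap K L b₁ * τ))
    (hk₂ : k₂ ≠ 0) (hm₁ : m₁ ≠ 0) (hC₁ : C₁ ≠ 0)
    (d₂ : e₂ * s₁ - s₂ * e₁ ≠ 0) (d₃ : a₁ * s₁ - b₁ * e₁ ≠ 0)
    (h : α • C₁ + β • T₁ + γ • C₂ = 0) : α = 0 ∧ β = 0 ∧ γ = 0 := by
  have h' := h
  simp only [Algebra.smul_def] at h
  have key : algebraMap K L (α * k₁ * (e₁ * e₂) + β * m₁ * (a₁ * e₂) + γ * k₂ * (e₁ * e₁))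
      + algebraMap K L (α * k₁ * (e₁ * s₂ + s₁ * e₂) + β * m₁ * (a₁ * s₂ + b₁ * e₂)
        + γ * k₂ * (2 * e₁ * s₁)) * τ
      + algebraMap K L (α * k₁ * (s₁ * s₂) + β * m₁ * (b₁ * s₂) + γ * k₂ * (s₁ * s₁)) * τ ^ 2
      = 0 := by
    apply mul_right_cancel₀ hτ
    simp only [map_add, map_mul, map_ofNat]
    set f := algebraMap K L
    linear_combination (f e₁ + f s₁ * τ) ^ 2 * (f e₂ + f s₂ * τ) * h
      - f α * (f e₁ + f s₁ * τ) * (f e₂ + f s₂ * τ) * h₁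
      - f β * (f e₂ + f s₂ * τ) * h₃
      - f γ * (f e₁ + f s₁ * τ) ^ 2 * h₂
  obtain ⟨a, b, c⟩ := hind _ _ _ key
  have hβ : β * (m₁ * (a₁ * s₁ - b₁ * e₁) * (e₂ * s₁ - s₂ * e₁)) = 0 := by
    linear_combination s₁ ^ 2 * a - s₁ * e₁ * b + e₁ ^ 2 * c
  have hγ : γ * (k₂ * (e₂ * s₁ - s₂ * e₁) ^ 2) = 0 := by
    linear_combination s₂ ^ 2 * a - s₂ * e₂ * b + e₂ ^ 2 * c
  have hβ' := (mul_eq_zero.1 hβ).resolve_right (mul_ne_zero (mul_ne_zero hm₁ d₃) d₂)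
  have hγ' := (mul_eq_zero.1 hγ).resolve_right (mul_ne_zero hk₂ (pow_ne_zero 2 d₂))
  refine ⟨?_, hβ', hγ'⟩
  rw [hβ', hγ'] at h'
  simpa [hC₁] using h'

/-- C := {[θ⁻(e)τ] : e ∈ K} ∪ {[τ]} is a nondegenerate conic of q+1 points; with
C_e := [θ⁻(e)τ], T_e := [θ⁻(e)²τ] (e ∈ K) and C_∞ := [τ], T_∞ := [τ²], for each index the points
C_e and T_e are distinct, T_e ∉ C, and the line through C_e and T_e meets C only in C_e, i.e.
C_eT_e is the tangent line to C at C_e. -/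
theorem tangent_splash_stmt_5
    (q : ℕ) (K L : Type) [Field K] [Field L] [Algebra K L] [Fintype K]
    (hK : Fintype.card K = q)
    (τ : L) (t₀ t₁ t₂ : K)
    (B : Basis (Fin 3) K L) (hB0 : B 0 = 1) (hB1 : B 1 = τ) (hB2 : B 2 = τ ^ 2)
    (hτ3 : τ ^ 3 = algebraMap K L t₂ * τ ^ 2 + algebraMap K L t₁ * τ + algebraMap K L t₀)
    (hprim : ∀ x : L, x ≠ 0 → ∃ n : ℕ, τ ^ n = x)
    -- the vectors representing the points C_e (e ∈ K) and C_∞ (index `none`)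
    (Cvec : Option K → L)
    (hCe : ∀ e : K, Cvec (some e) =
      (algebraMap K L e + τ ^ q) * (algebraMap K L e + τ ^ q ^ 2) * τ)
    (hCinf : Cvec none = τ)
    (hC0 : ∀ i : Option K, Cvec i ≠ 0)
    -- the vectors representing the points T_e (e ∈ K) and T_∞ (index `none`)
    (Tvec : Option K → L)
    (hTe : ∀ e : K, Tvec (some e) =
      ((algebraMap K L e + τ ^ q) * (algebraMap K L e + τ ^ q ^ 2)) ^ 2 * τ)
    (hTinf : Tvec none = τ ^ 2)
    (hT0 : ∀ i : Option K, Tvec i ≠ 0) :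
    -- C is a nondegenerate conic of q+1 points
    (Set.range (fun i : Option K => Projectivization.mk K (Cvec i) (hC0 i))).ncard = q + 1 ∧
    NoThreeCollinear K L
      (Set.range (fun i : Option K => Projectivization.mk K (Cvec i) (hC0 i))) ∧
    -- for each e ∈ K ∪ {∞}: C_e ≠ T_e, T_e ∉ C, and the line C_eT_e, which is a line,
    -- meets C exactly in C_e
    (∀ i : Option K,
      Projectivization.mk K (Cvec i) (hC0 i) ≠ Projectivization.mk K (Tvec i) (hT0 i) ∧
      Projectivization.mk K (Tvec i) (hT0 i) ∉
        Set.range (fun j : Option K => Projectivization.mk K (Cvec j) (hC0 j)) ∧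
      Module.finrank K (Submodule.span K {Cvec i, Tvec i}) = 2 ∧
      ∀ P ∈ Set.range (fun j : Option K => Projectivization.mk K (Cvec j) (hC0 j)),
        P.submodule ≤ Submodule.span K {Cvec i, Tvec i} →
          P = Projectivization.mk K (Cvec i) (hC0 i)) := by
  classical
  have hτ : τ ≠ 0 := hCinf ▸ hC0 none
  have hind : ∀ a b c : K,
      algebraMap K L a + algebraMap K L b * τ + algebraMap K L c * τ ^ 2 = 0 →
      a = 0 ∧ b = 0 ∧ c = 0 := by
    intro a b c h
    have := Fintype.linearIndependent_iff.1 B.linearIndependent ![a, b, c] (by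
      simpa [Fin.sum_univ_three, hB0, hB1, hB2, Algebra.smul_def] using h)
    exact ⟨this 0, this 1, this 2⟩
  have hfin : Module.finrank K L = 3 := by
    simpa using Module.finrank_eq_card_basis B
  have hmf : Module.Finite K L := Module.Finite.of_basis B
  have hLfin : Finite L := Module.finite_of_finite K
  have hfrob : ∀ e : K, algebraMap K L e + τ ^ q = (algebraMap K L e + τ) ^ q := by
    intro e
    have := map_add (FiniteField.frobeniusAlgHom K L) (algebraMap K L e) τ
    rw [AlgHom.commutes] at this
    simpa [FiniteField.frobeniusAlgHom, hK] using this.symm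
  have hfrob2 : ∀ e : K, algebraMap K L e + τ ^ q ^ 2 = (algebraMap K L e + τ) ^ q ^ 2 := by
    intro e
    have h2 := map_add (FiniteField.frobeniusAlgHom K L) (algebraMap K L e) (τ ^ q)
    rw [AlgHom.commutes] at h2
    simp only [FiniteField.coe_frobeniusAlgHom, hK] at h2
    rw [sq, pow_mul, pow_mul, ← hfrob e, h2]
  have hnorm : ∀ e : K, (algebraMap K L e + τ ^ q) * (algebraMap K L e + τ ^ q ^ 2) *
      (algebraMap K L e + τ) = algebraMap K L (Algebra.norm K (algebraMap K L e + τ)) := by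
    intro e
    rw [FiniteField.algebraMap_norm_eq_prod_pow, hfin, hfrob, hfrob2]
    simp only [Finset.prod_range_succ, Finset.prod_range_zero, Nat.card_eq_fintype_card, hK]
    ring
  have hx0 : ∀ e : K, algebraMap K L e + τ ≠ 0 := by
    intro e h
    have := hind e 1 0 (by simpa using h)
    exact one_ne_zero this.2.1
  let E : Option K → K := fun i => i.elim 1 id
  let S : Option K → K := fun i => i.elim 0 (fun _ => 1)
  let A : Option K → K := fun i => i.elim 0 (fun _ => 1)
  let D : Option K → K := fun i => i.elim 1 (fun _ => 0)
  have hC : ∀ i, ∃ k : K, k ≠ 0 ∧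
      Cvec i * (algebraMap K L (E i) + algebraMap K L (S i) * τ) = algebraMap K L k * τ := by
    rintro (_ | e)
    · exact ⟨1, one_ne_zero, by simp [E, S, hCinf]⟩
    · refine ⟨_, Algebra.norm_ne_zero_iff.2 (hx0 e), ?_⟩
      rw [← hnorm, hCe]
      simp only [E, S, Option.elim, id, map_one]
      ring
  have hT : ∀ i, ∃ k : K, k ≠ 0 ∧
      Tvec i * (algebraMap K L (E i) + algebraMap K L (S i) * τ) ^ 2 = algebraMap K L k * τ *
        (algebraMap K L (A i) + algebraMap K L (D i) * τ) := by
    rintro (_ | e)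
    · exact ⟨1, one_ne_zero, by simp [E, S, A, D, hTinf, sq]⟩
    · refine ⟨_, pow_ne_zero 2 (Algebra.norm_ne_zero_iff.2 (hx0 e)), ?_⟩
      rw [map_pow, ← hnorm, hTe]
      simp only [E, S, A, D, Option.elim, id, map_one, map_zero]
      ring
  have hdet : ∀ i j, i ≠ j → E j * S i - S j * E i ≠ 0 := by
    rintro (_ | e) (_ | f) h <;> simp [E, S] at h ⊢
    intro h'
    exact h (sub_eq_zero.1 h').symm
  have hdetT : ∀ i, A i * S i - D i * E i ≠ 0 := by
    rintro (_ | e) <;> simp [E, S, A, D]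
  choose k hk hCk using hC
  choose m hm hTm using hT
  have tan : ∀ i j, i ≠ j → ∀ α β γ : K, α • Cvec i + β • Tvec i + γ • Cvec j = 0 →
      α = 0 ∧ β = 0 ∧ γ = 0 := fun i j hij α β γ h =>
    aux_tan τ hτ hind (E i) (S i) (E j) (S j) (A i) (D i) (k i) (k j) (m i) α β γ _ _ _
      (hCk i) (hCk j) (hTm i) (hk j) (hm i) (hC0 i) (hdet i j hij) (hdetT i) h
  have three : ∀ i j l, i ≠ j → i ≠ l → ∀ α β γ : K,
      α • Cvec i + β • Cvec j + γ • Cvec l = 0 → α = 0 := fun i j l hij hil α β γ h =>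
    aux_three τ hτ hind (E i) (S i) (E j) (S j) (E l) (S l) (k i) (k j) (k l) α β γ _ _ _
      (hCk i) (hCk j) (hCk l) (hk i) (hdet i j hij) (hdet i l hil) h
  have hother : ∀ i : Option K, ∃ j, i ≠ j := fun i => by
    obtain ⟨j, hj⟩ := exists_ne i
    exact ⟨j, hj.symm⟩
  have hinj : Function.Injective (fun i : Option K => Projectivization.mk K (Cvec i) (hC0 i)) := by
    intro i j h
    by_contra hij
    obtain ⟨a, ha⟩ := (Projectivization.mk_eq_mk_iff' K _ _ _ _).1 h
    have := tan i j hij 1 0 (-a) (by rw [← ha]; simp)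
    exact one_ne_zero this.1
  have hCT : ∀ i, ∀ α β : K, α • Cvec i + β • Tvec i = 0 → α = 0 ∧ β = 0 := by
    intro i α β h
    obtain ⟨j, hj⟩ := hother i
    have := tan i j hj α β 0 (by simpa using h)
    exact ⟨this.1, this.2.1⟩
  refine ⟨?_, ?_, ?_⟩
  · rw [← Set.image_univ, Set.ncard_image_of_injective _ hinj, Set.ncard_univ,
      Nat.card_eq_fintype_card, Fintype.card_option, hK]
  · rintro _ _ _ ⟨i, rfl⟩ ⟨j, rfl⟩ ⟨l, rfl⟩ hij hil hjl W hW ⟨h1, h2, h3⟩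
    have hij : i ≠ j := fun h => hij (by rw [h])
    have hil : i ≠ l := fun h => hil (by rw [h])
    have hjl : j ≠ l := fun h => hjl (by rw [h])
    simp only [Projectivization.submodule_mk, Submodule.span_singleton_le_iff_mem] at h1 h2 h3
    have hli : LinearIndependent K
        (![⟨Cvec i, h1⟩, ⟨Cvec j, h2⟩, ⟨Cvec l, h3⟩] : Fin 3 → W) := by
      rw [Fintype.linearIndependent_iff]
      intro g hg
      have hg' : g 0 • Cvec i + g 1 • Cvec j + g 2 • Cvec l = 0 := by
        have := congrArg Subtype.val hg
        simpa [Fin.sum_univ_three] using this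
      have e0 := three i j l hij hil _ _ _ hg'
      have e1 := three j i l hij.symm hjl (g 1) (g 0) (g 2) (by rw [← hg']; abel)
      have e2 := three l i j hil.symm hjl.symm (g 2) (g 0) (g 1) (by rw [← hg']; abel)
      intro x
      fin_cases x
      exacts [e0, e1, e2]
    have := hli.fintype_card_le_finrank
    rw [hW] at this
    simp at this
  · intro i
    have hne : Projectivization.mk K (Cvec i) (hC0 i) ≠ Projectivization.mk K (Tvec i) (hT0 i) := by
      intro h
      obtain ⟨a, ha⟩ := (Projectivization.mk_eq_mk_iff' K _ _ _ _).1 h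
      have := hCT i 1 (-a) (by rw [← ha]; simp)
      exact one_ne_zero this.1
    refine ⟨hne, ?_, ?_, ?_⟩
    · rintro ⟨j, hj⟩
      by_cases hij : i = j
      · subst hij
        exact hne hj
      · obtain ⟨a, ha⟩ := (Projectivization.mk_eq_mk_iff' K _ _ _ _).1 hj
        have := tan i j hij 0 (-a) 1 (by rw [← ha]; simp)
        exact one_ne_zero this.2.2
    · have := finrank_span_eq_card (LinearIndependent.pair_iff.2 (hCT i))
      have hr : Set.range ![Cvec i, Tvec i] = {Cvec i, Tvec i} := by
        ext x
        simp [or_comm]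
      rw [hr] at this
      simpa using this
    · rintro _ ⟨j, rfl⟩ h
      simp only [Projectivization.submodule_mk, Submodule.span_singleton_le_iff_mem] at h
      obtain ⟨a, b, hab⟩ := Submodule.mem_span_pair.1 h
      by_contra hne'
      have hij : i ≠ j := fun h => hne' (by rw [h])
      have := tan i j hij a b (-1) (by rw [hab]; simp)
      exact one_ne_zero (neg_eq_zero.1 this.2.2)

end
end

section
/- Suppose q is even. Then the q+1 points D_e := [θ⁻(e)²τ] (e ∈ K) and D_∞ := [τ] of ℙ_K(L) are pairwise distinct and form a special conic: there exists a quadratic form over K in the coordinates (y₀,y₁,y₂) whose zero set in ℙ_K(L) is exactly {D_e : e ∈ K} ∪ {D_∞}, this zero set is a nondegenerate conic, and the form, evaluated over L, vanishes at the transversal vector R. (This set of points is the shadow, in the centre, of the order-q-subline {(e+τ : e : e+τ) : e ∈ K} ∪ {(1:1:1)} in the Bruck–Bose representation; by transitivity every shadow of an order-q-subline disjoint from ℓ∞ is projectively equivalent to it.) -/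
open scoped LinearAlgebra.Projectivization
open Module

noncomputable section

section helpers

variable {K L : Type} [Field K] [Field L] [Algebra K L]

/-- Linear independence of `1, τ, τ²` in explicit form. -/
lemma ts_indep {τ : L} (B : Basis (Fin 3) K L) (hB0 : B 0 = 1) (hB1 : B 1 = τ) (hB2 : B 2 = τ ^ 2)
    {a b c : K} (h : algebraMap K L a + algebraMap K L b * τ + algebraMap K L c * τ ^ 2 = 0) :
    a = 0 ∧ b = 0 ∧ c = 0 := by
  have hl := B.linearIndependent
  rw [Fintype.linearIndependent_iff] at hl
  have := hl ![a, b, c] (by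
    simp only [Fin.sum_univ_three, hB0, hB1, hB2, Algebra.smul_def]
    simpa using h)
  exact ⟨this 0, this 1, this 2⟩

lemma ts_coords {τ : L} (B : Basis (Fin 3) K L) (hB0 : B 0 = 1) (hB1 : B 1 = τ) (hB2 : B 2 = τ ^ 2)
    (v : L) : v = algebraMap K L (B.repr v 0) + algebraMap K L (B.repr v 1) * τ
      + algebraMap K L (B.repr v 2) * τ ^ 2 := by
  conv_lhs => rw [← B.sum_repr v]
  simp only [Fin.sum_univ_three, hB0, hB1, hB2, Algebra.smul_def, mul_one]

def tsA0 (t₀ t₁ t₂ y0 y1 y2 : K) : K :=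
  (y0 + t₁ * y2) * (y0 + t₂ * y1 + (t₁ + t₂ ^ 2) * y2)
    - (t₀ * y2 + t₁ * y1 + t₁ * t₂ * y2) * (y1 + t₂ * y2)
def tsA1 (t₀ t₁ t₂ y0 y1 y2 : K) : K :=
  y2 * (t₀ * y2 + t₁ * y1 + t₁ * t₂ * y2) - y1 * (y0 + t₂ * y1 + (t₁ + t₂ ^ 2) * y2)
def tsA2 (t₁ t₂ y0 y1 y2 : K) : K :=
  y1 * (y1 + t₂ * y2) - y2 * (y0 + t₁ * y2)
/-- The norm form. -/
def tsN (t₀ t₁ t₂ y0 y1 y2 : K) : K :=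
  y0 * tsA0 t₀ t₁ t₂ y0 y1 y2 + t₀ * y2 * tsA1 t₀ t₁ t₂ y0 y1 y2
    + t₀ * (y1 + t₂ * y2) * tsA2 t₁ t₂ y0 y1 y2
/-- The conic. -/
def tsc (t₀ t₁ t₂ : K) : Fin 6 → K := ![1, 0, -(t₀ * t₂), t₂, t₁ + t₂ ^ 2, -t₀]

lemma tsN_mul (t₀ t₁ t₂ y0 y1 y2 z0 z1 z2 : K) :
    tsN t₀ t₁ t₂ y0 y1 y2 * tsN t₀ t₁ t₂ z0 z1 z2 =
    tsN t₀ t₁ t₂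
      (y0 * z0 + t₀ * y2 * z1 + t₀ * (y1 + t₂ * y2) * z2)
      (y1 * z0 + (y0 + t₁ * y2) * z1 + (t₀ * y2 + t₁ * (y1 + t₂ * y2)) * z2)
      (y2 * z0 + (y1 + t₂ * y2) * z1 + (y0 + t₁ * y2 + t₂ * (y1 + t₂ * y2)) * z2) := by
  simp only [tsN, tsA0, tsA1, tsA2]; ring

lemma tsN_ne {τ : L} {t₀ t₁ t₂ : K}
    (B : Basis (Fin 3) K L) (hB0 : B 0 = 1) (hB1 : B 1 = τ) (hB2 : B 2 = τ ^ 2)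
    (hτ3 : τ ^ 3 = algebraMap K L t₂ * τ ^ 2 + algebraMap K L t₁ * τ + algebraMap K L t₀)
    (v : L) (hv : v ≠ 0) :
    tsN t₀ t₁ t₂ (B.repr v 0) (B.repr v 1) (B.repr v 2) ≠ 0 := by
  have h1 := ts_coords B hB0 hB1 hB2 v
  have h2 := ts_coords B hB0 hB1 hB2 v⁻¹
  have h3 : v * v⁻¹ = 1 := mul_inv_cancel₀ hv
  generalize v⁻¹ = w at *
  intro h0
  have hm := tsN_mul t₀ t₁ t₂ (B.repr v 0) (B.repr v 1) (B.repr v 2)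
    (B.repr w 0) (B.repr w 1) (B.repr w 2)
  rw [h0, zero_mul] at hm
  generalize B.repr v 0 = y0 at *
  generalize B.repr v 1 = y1 at *
  generalize B.repr v 2 = y2 at *
  generalize B.repr w 0 = z0 at *
  generalize B.repr w 1 = z1 at *
  generalize B.repr w 2 = z2 at *
  obtain ⟨e0, e1, e2⟩ := ts_indep B hB0 hB1 hB2
    (a := (y0 * z0 + t₀ * y2 * z1 + t₀ * (y1 + t₂ * y2) * z2) - 1)
    (b := (y1 * z0 + (y0 + t₁ * y2) * z1 + (t₀ * y2 + t₁ * (y1 + t₂ * y2)) * z2))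
    (c := (y2 * z0 + (y1 + t₂ * y2) * z1 + (y0 + t₁ * y2 + t₂ * (y1 + t₂ * y2)) * z2)) (by
      rw [h1, h2] at h3
      simp only [map_add, map_mul, map_sub, map_one]
      linear_combination h3 - (algebraMap K L y1 * algebraMap K L z2 + algebraMap K L y2 * algebraMap K L z1 + algebraMap K L y2 * algebraMap K L z2 * (τ + algebraMap K L t₂)) * hτ3)
  rw [e1, e2, sub_eq_zero.1 e0] at hm
  simp [tsN, tsA0, tsA1, tsA2] at hm

/-- `τ * adj v` has middle coordinate the value of the conic. -/
lemma ts_adj {τ : L} {t₀ t₁ t₂ : K}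
    (B : Basis (Fin 3) K L) (hB0 : B 0 = 1) (hB1 : B 1 = τ) (hB2 : B 2 = τ ^ 2)
    (hτ3 : τ ^ 3 = algebraMap K L t₂ * τ ^ 2 + algebraMap K L t₁ * τ + algebraMap K L t₀)
    (v : L) : ∃ x y : K,
      v * (algebraMap K L x + algebraMap K L (conicEval K K (tsc t₀ t₁ t₂) (fun i => B.repr v i)) * τ
        + algebraMap K L y * τ ^ 2) =
      algebraMap K L (tsN t₀ t₁ t₂ (B.repr v 0) (B.repr v 1) (B.repr v 2)) * τ := by
  have h1 := ts_coords B hB0 hB1 hB2 v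
  simp only [conicEval]
  generalize B.repr v 0 = y0 at *
  generalize B.repr v 1 = y1 at *
  generalize B.repr v 2 = y2 at *
  refine ⟨t₀ * tsA2 t₁ t₂ y0 y1 y2, tsA1 t₀ t₁ t₂ y0 y1 y2 + t₂ * tsA2 t₁ t₂ y0 y1 y2, ?_⟩
  have hA : v * (algebraMap K L (tsA0 t₀ t₁ t₂ y0 y1 y2) + algebraMap K L (tsA1 t₀ t₁ t₂ y0 y1 y2) * τ
      + algebraMap K L (tsA2 t₁ t₂ y0 y1 y2) * τ ^ 2) = algebraMap K L (tsN t₀ t₁ t₂ y0 y1 y2) := by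
    rw [h1]
    simp only [tsN, tsA0, tsA1, tsA2, map_add, map_mul, map_sub, map_one, map_pow]
    generalize algebraMap K L y0 = y0 at *
    generalize algebraMap K L y1 = y1 at *
    generalize algebraMap K L y2 = y2 at *
    generalize algebraMap K L t₀ = t₀ at *
    generalize algebraMap K L t₁ = t₁ at *
    generalize algebraMap K L t₂ = t₂ at *
    linear_combination (y1 * (y1 * (y1 + t₂ * y2) - y2 * (y0 + t₁ * y2)) + y2 * (y2 * (t₀ * y2 + t₁ * y1 + t₁ * t₂ * y2) - y1 * (y0 + t₂ * y1 + (t₁ + t₂ ^ 2) * y2)) + y2 * (y1 * (y1 + t₂ * y2) - y2 * (y0 + t₁ * y2)) * (τ + t₂)) * hτ3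
  rw [← hA]
  have hQ : algebraMap K K (tsc t₀ t₁ t₂ 0) * (y0 * y0) + algebraMap K K (tsc t₀ t₁ t₂ 1) * (y1 * y1) +
    algebraMap K K (tsc t₀ t₁ t₂ 2) * (y2 * y2) + algebraMap K K (tsc t₀ t₁ t₂ 3) * (y0 * y1) +
    algebraMap K K (tsc t₀ t₁ t₂ 4) * (y0 * y2) + algebraMap K K (tsc t₀ t₁ t₂ 5) * (y1 * y2)
    = tsA0 t₀ t₁ t₂ y0 y1 y2 + t₁ * tsA2 t₁ t₂ y0 y1 y2 := by
    simp [tsc, tsA0, tsA2]; ring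
  rw [hQ]
  simp only [map_add, map_mul]
  linear_combination -v * algebraMap K L (tsA2 t₁ t₂ y0 y1 y2) * hτ3

lemma ts_conic_iff {τ : L} {t₀ t₁ t₂ : K}
    (B : Basis (Fin 3) K L) (hB0 : B 0 = 1) (hB1 : B 1 = τ) (hB2 : B 2 = τ ^ 2)
    (hτ3 : τ ^ 3 = algebraMap K L t₂ * τ ^ 2 + algebraMap K L t₁ * τ + algebraMap K L t₀)
    (v : L) (hv : v ≠ 0) :
    conicEval K K (tsc t₀ t₁ t₂) (fun i => B.repr v i) = 0 ↔
    ∃ x y k : K, k ≠ 0 ∧ v * (algebraMap K L x + algebraMap K L y * τ ^ 2) = algebraMap K L k * τ := by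
  obtain ⟨x, y, h⟩ := ts_adj B hB0 hB1 hB2 hτ3 v
  have hN := tsN_ne B hB0 hB1 hB2 hτ3 v hv
  generalize tsN t₀ t₁ t₂ (B.repr v 0) (B.repr v 1) (B.repr v 2) = N at *
  generalize conicEval K K (tsc t₀ t₁ t₂) (fun i => B.repr v i) = Q at *
  constructor
  · rintro rfl
    exact ⟨x, y, N, hN, by rw [← h]; simp⟩
  · rintro ⟨x', y', k, hk, h'⟩
    have : v * (algebraMap K L (k * x - N * x') + algebraMap K L (k * Q) * τ
        + algebraMap K L (k * y - N * y') * τ ^ 2) = 0 := by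
      simp only [map_sub, map_mul]
      linear_combination algebraMap K L k * h - algebraMap K L N * h'
    have := (ts_indep B hB0 hB1 hB2 ((mul_eq_zero.1 this).resolve_left hv)).2.1
    exact (mul_eq_zero.1 this).resolve_left hk

/-- The parameters of the points in the pencil `⟨1, τ²⟩`. -/
def tsx : Option K → K
  | none => 1
  | some e => e ^ 2
def tsy : Option K → K
  | none => 0
  | some _ => 1

lemma ts_delta (h2 : (2 : K) = 0) {i j : Option K} (h : tsx i * tsy j - tsx j * tsy i = 0) :
    i = j := by
  rcases i with _ | e <;> rcases j with _ | f <;> simp [tsx, tsy] at h ⊢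
  have : (e - f) ^ 2 = 0 := by linear_combination h + (f ^ 2 - e * f) * h2
  exact sub_eq_zero.1 (pow_eq_zero_iff (by norm_num) |>.1 this)

end helpers

/-- for q even, the q+1 points D_e := [θ⁻(e)²τ] (e ∈ K) and D_∞ := [τ] of ℙ_K(L)
are pairwise distinct and form a special conic. -/
theorem tangent_splash_stmt_11
    (q : ℕ) (K L : Type) [Field K] [Field L] [Algebra K L] [Fintype K]
    (hK : Fintype.card K = q)
    (τ : L) (t₀ t₁ t₂ : K)
    (B : Basis (Fin 3) K L) (hB0 : B 0 = 1) (hB1 : B 1 = τ) (hB2 : B 2 = τ ^ 2)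
    (hτ3 : τ ^ 3 = algebraMap K L t₂ * τ ^ 2 + algebraMap K L t₁ * τ + algebraMap K L t₀)
    (hprim : ∀ x : L, x ≠ 0 → ∃ n : ℕ, τ ^ n = x)
    (hqeven : Even q)
    -- the vectors representing the points D_e (e ∈ K) and D_∞ (index `none`)
    (Dvec : Option K → L)
    (hDe : ∀ e : K, Dvec (some e) =
      ((algebraMap K L e + τ ^ q) * (algebraMap K L e + τ ^ q ^ 2)) ^ 2 * τ)
    (hDinf : Dvec none = τ)
    (hD0 : ∀ i : Option K, Dvec i ≠ 0) :
    -- the q+1 points are pairwise distinct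
    Function.Injective (fun i : Option K => Projectivization.mk K (Dvec i) (hD0 i)) ∧
    -- and they form a special conic
    IsSpecialConic q K L B τ t₀ t₁ t₂
      (Set.range (fun i : Option K => Projectivization.mk K (Dvec i) (hD0 i))) := by
  subst hK
  classical
  have hr : ringChar K = 2 := FiniteField.even_card_iff_char_two.2 (Nat.even_iff.1 hqeven)
  have h2 : (2 : K) = 0 := by
    have := ringChar.Nat.cast_ringChar (R := K)
    rw [hr] at this; exact_mod_cast this
  have h2L : (2 : L) = 0 := by
    rw [← map_ofNat (algebraMap K L) 2, h2, map_zero]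
  have hsq : ∀ a : K, ∃ b : K, a = b ^ 2 := fun a => by
    obtain ⟨b, hb⟩ := FiniteField.isSquare_of_char_two hr a
    exact ⟨b, by rw [hb, sq]⟩
  have hfin : Module.Finite K L := Module.Finite.of_basis B
  have hfr : Module.finrank K L = 3 := by simp [Module.finrank_eq_card_basis B]
  have hLf : Finite L := Module.finite_of_finite K
  have hind := @ts_indep K L _ _ _ τ B hB0 hB1 hB2
  have hτ0 : τ ≠ 0 := hDinf ▸ hD0 none
  -- independence of 1, τ², τ⁴
  have hind2 : ∀ a b c : K, algebraMap K L a + algebraMap K L b * τ ^ 2 + algebraMap K L c * τ ^ 4 = 0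
      → a = 0 ∧ b = 0 ∧ c = 0 := by
    intro a b c h
    obtain ⟨a, rfl⟩ := hsq a
    obtain ⟨b, rfl⟩ := hsq b
    obtain ⟨c, rfl⟩ := hsq c
    have : (algebraMap K L a + algebraMap K L b * τ + algebraMap K L c * τ ^ 2) ^ 2 = 0 := by
      simp only [map_pow] at h
      linear_combination h + (algebraMap K L a * algebraMap K L b * τ + algebraMap K L a * algebraMap K L c * τ ^ 2 + algebraMap K L b * algebraMap K L c * τ ^ 3) * h2L
    obtain ⟨ha, hb, hc⟩ := hind ((pow_eq_zero_iff (by norm_num)).1 this)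
    simp [ha, hb, hc]
  -- the key relation
  have hkey : ∀ i : Option K, ∃ k : K, k ≠ 0 ∧
      Dvec i * (algebraMap K L (tsx i) + algebraMap K L (tsy i) * τ ^ 2) = algebraMap K L k * τ := by
    rintro (_ | e)
    · exact ⟨1, one_ne_zero, by simp [tsx, tsy, hDinf]⟩
    · have he : algebraMap K L e + τ ≠ 0 := by
        intro h
        have := (hind (a := e) (b := 1) (c := 0) (by simpa using h)).2.1
        exact one_ne_zero this
      refine ⟨Algebra.norm K (algebraMap K L e + τ) ^ 2,
        pow_ne_zero _ (Algebra.norm_ne_zero_iff.2 he), ?_⟩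
      have hfrob : ∀ n : ℕ, (algebraMap K L e + τ) ^ (Fintype.card K ^ n)
          = algebraMap K L e + τ ^ (Fintype.card K ^ n) := by
        intro n
        induction n with
        | zero => simp
        | succ n ih =>
          rw [pow_succ, pow_mul, ih, pow_mul]
          have := map_add (FiniteField.frobeniusAlgHom K L) (algebraMap K L e) (τ ^ (Fintype.card K ^ n))
          rw [AlgHom.commutes] at this
          simpa using this
      have hn := FiniteField.algebraMap_norm_eq_prod_pow K L (algebraMap K L e + τ)
      rw [hfr] at hn
      simp only [Finset.prod_range_succ, Finset.prod_range_zero, Nat.card_eq_fintype_card, hfrob] at hn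
      rw [map_pow, hn, hDe]
      simp only [tsx, tsy, map_pow, map_one, pow_zero, pow_one]
      linear_combination -((algebraMap K L e + τ ^ Fintype.card K) * (algebraMap K L e + τ ^ Fintype.card K ^ 2)) ^ 2 * τ * (algebraMap K L e * τ) * h2L
  -- proportional weights
  have hprop : ∀ (v w : L) (hv : v ≠ 0) (hw : w ≠ 0) (u : L) (a b : K), a ≠ 0 → b ≠ 0 →
      v * u = algebraMap K L a * τ → w * u = algebraMap K L b * τ →
      Projectivization.mk K v hv = Projectivization.mk K w hw := by
    intro v w hv hw u a b ha hb h1 h2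
    rw [Projectivization.mk_eq_mk_iff']
    refine ⟨a / b, ?_⟩
    have hu : u ≠ 0 := by
      rintro rfl
      rw [mul_zero] at h1
      exact mul_ne_zero (by simpa using ha) hτ0 h1.symm
    apply mul_right_cancel₀ hu
    rw [Algebra.smul_def, mul_assoc, h1, h2, ← mul_assoc, ← map_mul, div_mul_cancel₀ _ hb]
  have hinj : Function.Injective (fun i : Option K => Projectivization.mk K (Dvec i) (hD0 i)) := by
    intro i j hij
    obtain ⟨a, ha⟩ := (Projectivization.mk_eq_mk_iff' K _ _ _ _).1 hij
    obtain ⟨k, hk, h1⟩ := hkey i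
    obtain ⟨l, hl, h3⟩ := hkey j
    rw [← ha, Algebra.smul_def] at h1
    have h4 : Dvec j * (algebraMap K L (l * a * tsx i - k * tsx j) + algebraMap K L 0 * τ
      + algebraMap K L (l * a * tsy i - k * tsy j) * τ ^ 2) = 0 := by
      simp only [map_sub, map_mul, map_zero]
      linear_combination algebraMap K L l * h1 - algebraMap K L k * h3
    obtain ⟨h5, -, h6⟩ := hind ((mul_eq_zero.1 h4).resolve_left (hD0 j))
    apply ts_delta h2
    have ha0 : a ≠ 0 := by
      rintro rfl
      exact hD0 i (by rw [← ha, zero_smul])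
    have : l * a * (tsx i * tsy j - tsx j * tsy i) = 0 := by
      linear_combination tsy j * h5 - tsx j * h6
    exact (mul_eq_zero.1 this).resolve_left (mul_ne_zero hl ha0)
  refine ⟨hinj, tsc t₀ t₁ t₂, ?_, ?_, ?_, ?_⟩
  · ext P
    simp only [conicZeroSet, Set.mem_setOf_eq]
    rw [ts_conic_iff B hB0 hB1 hB2 hτ3 P.rep P.rep_nonzero]
    constructor
    · rintro ⟨i, rfl⟩
      obtain ⟨a, ha⟩ := Projectivization.exists_smul_eq_mk_rep K (Dvec i) (hD0 i)
      obtain ⟨k, hk, h⟩ := hkey i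
      refine ⟨tsx i, tsy i, a * k, mul_ne_zero a.ne_zero hk, ?_⟩
      simp only
      rw [← ha, Units.smul_def, Algebra.smul_def, mul_assoc, h, map_mul, mul_assoc]
    · rintro ⟨x, y, k, hk, h⟩
      by_cases hy : y = 0
      · subst hy
        have hx : x ≠ 0 := by
          rintro rfl
          simp [hk, hτ0] at h
        refine ⟨none, ?_⟩
        rw [← P.mk_rep]
        refine hprop _ _ _ _ (algebraMap K L x) x k hx hk (by rw [hDinf, mul_comm]) (by simpa using h)
      · obtain ⟨e, he⟩ := hsq (x / y)
        obtain ⟨l, hl, h'⟩ := hkey (some e)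
        refine ⟨some e, ?_⟩
        rw [← P.mk_rep]
        refine hprop _ _ _ _ _ l (k / y) hl (div_ne_zero hk hy) h' ?_
        have hyL : algebraMap K L y ≠ 0 := by simpa using hy
        simp only [tsx, tsy, ← he]
        apply mul_right_cancel₀ hyL
        have e1 : algebraMap K L (x / y) * algebraMap K L y = algebraMap K L x := by
          rw [← map_mul, div_mul_cancel₀ _ hy]
        have e2 : algebraMap K L (k / y) * algebraMap K L y = algebraMap K L k := by
          rw [← map_mul, div_mul_cancel₀ _ hy]
        rw [map_one]
        linear_combination h + P.rep * e1 - τ * e2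
  · rw [← Set.image_univ, Set.ncard_image_of_injective _ hinj, Set.ncard_univ]
    simp
  · rintro _ _ _ ⟨i, rfl⟩ ⟨j, rfl⟩ ⟨l, rfl⟩ hij hil hjl W hW ⟨hi, hj, hl⟩
    have nij : i ≠ j := fun h => hij (by rw [h])
    have nil : i ≠ l := fun h => hil (by rw [h])
    have njl : j ≠ l := fun h => hjl (by rw [h])
    simp only [Projectivization.submodule_mk, Submodule.span_singleton_le_iff_mem] at hi hj hl
    obtain ⟨ki, hki, ei⟩ := hkey i
    obtain ⟨kj, hkj, ej⟩ := hkey j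
    obtain ⟨kl, hkl, el⟩ := hkey l
    have d1 : tsx i * tsy j - tsx j * tsy i ≠ 0 := fun h => nij (ts_delta h2 h)
    have d2 : tsx i * tsy l - tsx l * tsy i ≠ 0 := fun h => nil (ts_delta h2 h)
    have d3 : tsx j * tsy l - tsx l * tsy j ≠ 0 := fun h => njl (ts_delta h2 h)
    have hLI : LinearIndependent K ![Dvec i, Dvec j, Dvec l] := by
      rw [Fintype.linearIndependent_iff]
      intro g hg
      simp only [Fin.sum_univ_three, Algebra.smul_def] at hg
      simp only [Matrix.cons_val] at hg
      generalize Dvec i = Di at *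
      generalize Dvec j = Dj at *
      generalize Dvec l = Dl at *
      generalize tsx i = xi at *
      generalize tsx j = xj at *
      generalize tsx l = xl at *
      generalize tsy i = yi at *
      generalize tsy j = yj at *
      generalize tsy l = yl at *
      have hpoly : algebraMap K L (g 0 * ki * (xj * xl) + g 1 * kj * (xi * xl) + g 2 * kl * (xi * xj))
        + algebraMap K L (g 0 * ki * (xj * yl + xl * yj) + g 1 * kj * (xi * yl + xl * yi)
            + g 2 * kl * (xi * yj + xj * yi)) * τ ^ 2
        + algebraMap K L (g 0 * ki * (yj * yl) + g 1 * kj * (yi * yl) + g 2 * kl * (yi * yj)) * τ ^ 4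
          = 0 := by
        apply mul_right_cancel₀ hτ0
        simp only [map_add, map_mul]
        generalize algebraMap K L xi = xi at *
        generalize algebraMap K L xj = xj at *
        generalize algebraMap K L xl = xl at *
        generalize algebraMap K L yi = yi at *
        generalize algebraMap K L yj = yj at *
        generalize algebraMap K L yl = yl at *
        linear_combination (xi + yi * τ ^ 2) * (xj + yj * τ ^ 2) * (xl + yl * τ ^ 2) * hg
          - algebraMap K L (g 0) * (xj + yj * τ ^ 2) * (xl + yl * τ ^ 2) * ei
          - algebraMap K L (g 1) * (xi + yi * τ ^ 2) * (xl + yl * τ ^ 2) * ej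
          - algebraMap K L (g 2) * (xi + yi * τ ^ 2) * (xj + yj * τ ^ 2) * el
      obtain ⟨c0, c1, c2⟩ := hind2 _ _ _ hpoly
      have g0 : g 0 * (ki * ((xi * yj - xj * yi) * (xi * yl - xl * yi))) = 0 := by
        linear_combination yi ^ 2 * c0 - xi * yi * c1 + xi ^ 2 * c2
      have g1 : g 1 * (kj * ((xi * yj - xj * yi) * (xj * yl - xl * yj))) = 0 := by
        linear_combination -(yj ^ 2 * c0 - xj * yj * c1 + xj ^ 2 * c2)
      have g2 : g 2 * (kl * ((xi * yl - xl * yi) * (xj * yl - xl * yj))) = 0 := by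
        linear_combination yl ^ 2 * c0 - xl * yl * c1 + xl ^ 2 * c2
      intro m
      fin_cases m
      · exact (mul_eq_zero.1 g0).resolve_right (mul_ne_zero hki (mul_ne_zero d1 d2))
      · exact (mul_eq_zero.1 g1).resolve_right (mul_ne_zero hkj (mul_ne_zero d1 d3))
      · exact (mul_eq_zero.1 g2).resolve_right (mul_ne_zero hkl (mul_ne_zero d2 d3))
    have hle : Submodule.span K (Set.range ![Dvec i, Dvec j, Dvec l]) ≤ W := by
      rw [Submodule.span_le]
      rintro _ ⟨m, rfl⟩
      fin_cases m
      · exact hi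
      · exact hj
      · exact hl
    have h3 := finrank_span_eq_card hLI
    have h4 := Submodule.finrank_mono hle
    rw [h3, hW] at h4
    simp at h4
  · simp only [RvanishL, conicEval, tsc, Matrix.cons_val, map_neg, map_mul, map_add, map_pow,
      map_one, map_zero]
    linear_combination τ * hτ3

end
end

section
/- Suppose q is odd. Consider the q+1 pairwise distinct points D_e := [θ⁻(e)²τ] (e ∈ K) and D_∞ := [τ] of ℙ_K(L). Then no special conic of ℙ_K(L) contains three of these points: every quadratic form over K in the coordinates (y₀,y₁,y₂) whose zero set in ℙ_K(L) is a nondegenerate conic and which, evaluated over L, vanishes at the transversal vector R, vanishes at no more than two of the points D_e (e ∈ K ∪ {∞}). -/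
open scoped LinearAlgebra.Projectivization
open Module

noncomputable section

lemma vdm_zero {L : Type*} [Field L] {x y z P R S : L} (hxy : x ≠ y) (hxz : x ≠ z) (hyz : y ≠ z)
    (h0 : P + R + S = 0) (h1 : P * z + R * y + S * x = 0)
    (h2 : P * z ^ 2 + R * y ^ 2 + S * x ^ 2 = 0) : P = 0 ∧ R = 0 ∧ S = 0 := by
  have a1 : x - y ≠ 0 := sub_ne_zero.2 hxy
  have a2 : x - z ≠ 0 := sub_ne_zero.2 hxz
  have a3 : y - z ≠ 0 := sub_ne_zero.2 hyz
  refine ⟨?_, ?_, ?_⟩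
  · have : P * ((x - z) * (y - z)) = 0 := by linear_combination h2 - (x + y) * h1 + x * y * h0
    simpa [a1, a2, a3] using this
  · have : R * ((x - y) * (y - z)) = 0 := by
      linear_combination -h2 + (x + z) * h1 - x * z * h0
    simpa [a1, a2, a3] using this
  · have : S * ((x - y) * (x - z)) = 0 := by linear_combination h2 - (y + z) * h1 + y * z * h0
    simpa [a1, a2, a3] using this

lemma quad_zero {L : Type*} [Field L] {A B C a b c : L} (hab : a ≠ b) (hac : a ≠ c) (hbc : b ≠ c)
    (h0 : A * a ^ 2 + B * a + C = 0) (h1 : A * b ^ 2 + B * b + C = 0)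
    (h2 : A * c ^ 2 + B * c + C = 0) : A = 0 ∧ B = 0 ∧ C = 0 := by
  have a1 : a - b ≠ 0 := sub_ne_zero.2 hab
  have a2 : a - c ≠ 0 := sub_ne_zero.2 hac
  have a3 : b - c ≠ 0 := sub_ne_zero.2 hbc
  have hA : A = 0 := by
    have : A * ((a - b) * (a - c) * (b - c)) = 0 := by
      linear_combination (b - c) * h0 - (a - c) * h1 + (a - b) * h2
    simpa [a1, a2, a3] using this
  subst hA
  have hB : B = 0 := by
    have : B * (a - b) = 0 := by linear_combination h0 - h1
    simpa [a1] using this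
  subst hB
  exact ⟨rfl, rfl, by linear_combination h0⟩

lemma vieta {L : Type*} [Field L] {x y z t0 t1 t2 : L}
    (hxy : x ≠ y) (hxz : x ≠ z) (hyz : y ≠ z)
    (hx : x ^ 3 = t2 * x ^ 2 + t1 * x + t0) (hy : y ^ 3 = t2 * y ^ 2 + t1 * y + t0)
    (hz : z ^ 3 = t2 * z ^ 2 + t1 * z + t0) :
    t2 = x + y + z ∧ t1 = -(x * y + x * z + y * z) ∧ t0 = x * y * z := by
  obtain ⟨h2, h1, h0⟩ := quad_zero (A := t2 - (x + y + z)) (B := t1 + (x * y + x * z + y * z))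
    (C := t0 - x * y * z) hxy hxz hyz (by linear_combination -hx) (by linear_combination -hy)
    (by linear_combination -hz)
  exact ⟨by linear_combination h2, by linear_combination h1, by linear_combination h0⟩

/-- Quadratic form in coordinates adapted to the three conjugate transversal vectors. -/
lemma form_adapted {L : Type*} [Field L] {x y z : L} (hxy : x ≠ y) (hxz : x ≠ z) (hyz : y ≠ z)
    (c0 c1 c2 c3 c4 c5 : L) (Q : L → L → L → L)
    (hQ : Q = fun a b c => c0 * (a * a) + c1 * (b * b) + c2 * (c * c) + c3 * (a * b)
      + c4 * (a * c) + c5 * (b * c))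
    (hx : Q (-(y * z)) (y + z) (-1) = 0) (hy : Q (-(x * z)) (x + z) (-1) = 0)
    (hz : Q (-(x * y)) (x + y) (-1) = 0) :
    ∃ p r s : L, ∀ a b c : L, Q a b c =
      p * ((a + b * x + c * x ^ 2) * (a + b * y + c * y ^ 2)) +
      r * ((a + b * x + c * x ^ 2) * (a + b * z + c * z ^ 2)) +
      s * ((a + b * y + c * y ^ 2) * (a + b * z + c * z ^ 2)) := by
  have a1 : x - y ≠ 0 := sub_ne_zero.2 hxy
  have a2 : x - z ≠ 0 := sub_ne_zero.2 hxz
  have a3 : y - z ≠ 0 := sub_ne_zero.2 hyz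
  obtain ⟨d1, hd1⟩ : ∃ d, d * ((x - y) * (x - z)) = -1 := ⟨-1 / ((x - y) * (x - z)), by field_simp⟩
  obtain ⟨d2, hd2⟩ : ∃ d, d * ((x - y) * (y - z)) = 1 := ⟨1 / ((x - y) * (y - z)), by field_simp⟩
  obtain ⟨d3, hd3⟩ : ∃ d, d * ((x - z) * (y - z)) = -1 := ⟨-1 / ((x - z) * (y - z)), by field_simp⟩
  let pol : L → L → L → L → L → L → L := fun a b c a' b' c' =>
    c0 * (2 * a * a') + c1 * (2 * b * b') + c2 * (2 * c * c') + c3 * (a * b' + a' * b)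
      + c4 * (a * c' + a' * c) + c5 * (b * c' + b' * c)
  refine ⟨d1 * d2 * pol (-(y * z)) (y + z) (-1) (-(x * z)) (x + z) (-1),
    d1 * d3 * pol (-(y * z)) (y + z) (-1) (-(x * y)) (x + y) (-1),
    d2 * d3 * pol (-(x * z)) (x + z) (-1) (-(x * y)) (x + y) (-1), fun a b c => ?_⟩
  have e1 : d1 = -1 / ((x - y) * (x - z)) := by field_simp; linear_combination hd1
  have e2 : d2 = 1 / ((x - y) * (y - z)) := by field_simp; linear_combination hd2
  have e3 : d3 = -1 / ((x - z) * (y - z)) := by field_simp; linear_combination hd3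
  generalize hl : a + b * x + c * x ^ 2 = l
  generalize hm : a + b * y + c * y ^ 2 = m
  generalize hn : a + b * z + c * z ^ 2 = n
  have ha : a = l * d1 * (-(y * z)) + m * d2 * (-(x * z)) + n * d3 * (-(x * y)) := by
    rw [e1, e2, e3, ← hl, ← hm, ← hn]; field_simp; ring
  have hb : b = l * d1 * (y + z) + m * d2 * (x + z) + n * d3 * (x + y) := by
    rw [e1, e2, e3, ← hl, ← hm, ← hn]; field_simp; ring
  have hc : c = l * d1 * (-1) + m * d2 * (-1) + n * d3 * (-1) := by
    rw [e1, e2, e3, ← hl, ← hm, ← hn]; field_simp; ring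
  rw [ha, hb, hc]
  clear ha hb hc hl hm hn e1 e2 e3 hd1 hd2 hd3
  rw [hQ] at *
  simp only [pol] at *
  linear_combination (l * d1) ^ 2 * hx + (m * d2) ^ 2 * hy + (n * d3) ^ 2 * hz

/-- for q odd, the q+1 pairwise distinct points D_e := [θ⁻(e)²τ] (e ∈ K) and
D_∞ := [τ] of ℙ_K(L) have the property that no special conic of ℙ_K(L) contains three of them:
every quadratic form over K whose zero set is a nondegenerate conic and which vanishes (over L)
at the transversal vector R vanishes at no more than two of these points. -/
theorem tangent_splash_stmt_12
    (q : ℕ) (K L : Type) [Field K] [Field L] [Algebra K L] [Fintype K]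
    (hK : Fintype.card K = q)
    (τ : L) (t₀ t₁ t₂ : K)
    (B : Basis (Fin 3) K L) (hB0 : B 0 = 1) (hB1 : B 1 = τ) (hB2 : B 2 = τ ^ 2)
    (hτ3 : τ ^ 3 = algebraMap K L t₂ * τ ^ 2 + algebraMap K L t₁ * τ + algebraMap K L t₀)
    (hprim : ∀ x : L, x ≠ 0 → ∃ n : ℕ, τ ^ n = x)
    (hqodd : Odd q)
    -- the vectors representing the points D_e (e ∈ K) and D_∞ (index `none`)
    (Dvec : Option K → L)
    (hDe : ∀ e : K, Dvec (some e) =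
      ((algebraMap K L e + τ ^ q) * (algebraMap K L e + τ ^ q ^ 2)) ^ 2 * τ)
    (hDinf : Dvec none = τ)
    (hD0 : ∀ i : Option K, Dvec i ≠ 0) :
    -- the q+1 points are pairwise distinct
    Function.Injective (fun i : Option K => Projectivization.mk K (Dvec i) (hD0 i)) ∧
    -- no special conic contains three of them
    (∀ c : Fin 6 → K,
      (conicZeroSet K L B c).ncard = q + 1 →
      NoThreeCollinear K L (conicZeroSet K L B c) →
      RvanishL K L τ t₀ t₁ t₂ c →
      ∀ i j k : Option K,
        Projectivization.mk K (Dvec i) (hD0 i) ∈ conicZeroSet K L B c →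
        Projectivization.mk K (Dvec j) (hD0 j) ∈ conicZeroSet K L B c →
        Projectivization.mk K (Dvec k) (hD0 k) ∈ conicZeroSet K L B c →
        i = j ∨ i = k ∨ j = k) := by
  classical
  have hLfin : Module.Finite K L := Module.Finite.of_basis B
  have hLF : Finite L := Module.finite_of_finite K
  have hfr : Module.finrank K L = 3 := by simpa using Module.finrank_eq_card_basis B
  have hcardL : Nat.card L = q ^ 3 := by
    rw [Module.natCard_eq_pow_finrank (K := K), hfr, Nat.card_eq_fintype_card, hK]
  have hq1 : 1 < q := hK ▸ Fintype.one_lt_card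
  -- linear independence
  have hli : ∀ a b c : K, algebraMap K L a + algebraMap K L b * τ + algebraMap K L c * τ ^ 2 = 0 →
      a = 0 ∧ b = 0 ∧ c = 0 := by
    intro a b c h
    have := Fintype.linearIndependent_iff.1 B.linearIndependent ![a, b, c] (by
      simp [Fin.sum_univ_three, hB0, hB1, hB2, Algebra.smul_def]
      linear_combination h)
    exact ⟨this 0, this 1, this 2⟩
  have hinj : Function.Injective (algebraMap K L) := (algebraMap K L).injective
  have hdecomp : ∀ l : L, l = algebraMap K L (B.repr l 0) + algebraMap K L (B.repr l 1) * τ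
      + algebraMap K L (B.repr l 2) * τ ^ 2 := by
    intro l
    have := B.sum_repr l
    rw [Fin.sum_univ_three, hB0, hB1, hB2] at this
    simp only [Algebra.smul_def, mul_one] at this
    exact this.symm
  have h2 : (2 : K) ≠ 0 := by
    intro h
    have h2' : ringChar K = 2 := by
      have hd : ringChar K ∣ 2 := (ringChar.spec K 2).1 (by exact_mod_cast h)
      exact (Nat.prime_dvd_prime_iff_eq (CharP.char_is_prime K (ringChar K)) Nat.prime_two).1 hd
    have := FiniteField.even_card_of_char_two h2'
    rw [hK] at this
    exact (Nat.not_even_iff_odd.2 hqodd) (Nat.even_iff.2 this)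
  have h2L : (2 : L) ≠ 0 := by
    intro h; apply h2; apply hinj; rw [map_ofNat, map_zero]; exact h
  -- Frobenius
  obtain ⟨σ, hσ, hσF⟩ : ∃ σ : L →ₐ[K] L, (∀ x, σ x = x ^ q) ∧
      σ = FiniteField.frobeniusAlgHom K L :=
    ⟨FiniteField.frobeniusAlgHom K L, fun x => by simp [hK], rfl⟩
  have hσ3 : ∀ x, σ (σ (σ x)) = x := by
    intro x
    have hf : Fintype L := Fintype.ofFinite L
    rw [hσ, hσ, hσ, ← pow_mul, ← pow_mul]
    have := FiniteField.pow_card x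
    rw [← Nat.card_eq_fintype_card, hcardL] at this
    rw [show q * (q * q) = q ^ 3 by ring]; exact this
  have hs1 : τ ^ q = σ τ := (hσ τ).symm
  have hs2 : τ ^ q ^ 2 = σ (σ τ) := by rw [hσ, hσ, ← pow_mul, sq]
  have hτσ : τ ≠ σ τ := by
    intro h
    have h1 : FiniteField.frobeniusAlgHom K L = 1 := by
      rw [← hσF]
      ext w
      rw [AlgHom.one_apply]
      by_cases hw : w = 0
      · simp [hw]
      · obtain ⟨n, rfl⟩ := hprim w hw
        rw [map_pow, ← h]
    have h3 := FiniteField.orderOf_frobeniusAlgHom K L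
    rw [h1, orderOf_one, hfr] at h3
    omega
  set x := τ with hx
  set y := σ x with hy
  set z := σ y with hz
  have hzx : σ z = x := hσ3 x
  have hyz : y ≠ z := fun h => hτσ (σ.toRingHom.injective h)
  have hxz : x ≠ z := fun h => hyz (σ.toRingHom.injective (by
    show σ y = σ z
    rw [hzx, h]))
  have hx3 := hτ3
  have hy3 := congrArg σ hx3
  simp only [map_add, map_mul, map_pow, AlgHom.commutes, ← hy] at hy3
  have hz3 := congrArg σ hy3
  simp only [map_add, map_mul, map_pow, AlgHom.commutes, ← hz] at hz3
  obtain ⟨v2, v1, v0⟩ := vieta hτσ hxz hyz hx3 hy3 hz3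
  have hx0 : x ≠ 0 := by rw [← hDinf]; exact hD0 none
  have hy0 : y ≠ 0 := fun h => hx0 (σ.toRingHom.injective (h.trans (map_zero σ).symm))
  have hz0 : z ≠ 0 := fun h => hy0 (σ.toRingHom.injective (h.trans (map_zero σ).symm))
  -- inverse points
  obtain ⟨E, hEn, hEs⟩ : ∃ E : Option K → L, E none = 1 ∧
      ∀ e, E (some e) = (algebraMap K L e + x) ^ 2 :=
    ⟨fun o => o.elim 1 fun e => (algebraMap K L e + x) ^ 2, rfl, fun _ => rfl⟩
  have hE0 : ∀ i, E i ≠ 0 := by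
    rintro (_ | e)
    · simp [hEn]
    · rw [hEs]
      refine pow_ne_zero _ fun h => ?_
      have := hli e 1 0 (by simpa using h)
      simpa using this.2.1
  have hDE : ∀ i, ∃ n : K, Dvec i * E i = algebraMap K L n * x := by
    rintro (_ | e)
    · exact ⟨1, by simp [hEn, hDinf]⟩
    · refine ⟨(e ^ 3 + t₂ * e ^ 2 - t₁ * e + t₀) ^ 2, ?_⟩
      rw [hEs, hDe, hs1, hs2]
      simp only [map_pow, map_add, map_sub, map_mul, v2, v1, v0]
      ring
  have hDE' : ∀ i (a : Kˣ), ∃ n : K, n ≠ 0 ∧ (a • Dvec i) * E i = algebraMap K L n * x := by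
    intro i a
    obtain ⟨n, hn⟩ := hDE i
    have hn0 : n ≠ 0 := by
      rintro rfl
      simp [hD0 i, hE0 i] at hn
    refine ⟨a * n, mul_ne_zero a.ne_zero hn0, ?_⟩
    rw [Units.smul_def, Algebra.smul_def, map_mul, mul_assoc, hn, mul_assoc]
  refine ⟨?_, ?_⟩
  · intro i j hij
    obtain ⟨a, ha⟩ := (Projectivization.mk_eq_mk_iff K _ _ (hD0 i) (hD0 j)).1 hij
    obtain ⟨n, hn0, hn⟩ := hDE' j a
    obtain ⟨m, hm0, hm⟩ := hDE' i 1
    rw [ha] at hn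
    rw [one_smul] at hm
    have hrel : algebraMap K L n * E i = algebraMap K L m * E j := by
      have : (Dvec i * x) * (algebraMap K L n * E i) = (Dvec i * x) * (algebraMap K L m * E j) := by
        linear_combination (-Dvec i * E i) * hn + Dvec i * E j * hm
      exact mul_left_cancel₀ (mul_ne_zero (hD0 i) hx0) this
    rcases i with _ | e <;> rcases j with _ | e'
    · rfl
    · rw [hEn, hEs] at hrel
      have := hli (m * e' ^ 2 - n) (2 * m * e') m (by
        simp only [map_sub, map_mul, map_pow, map_ofNat]; linear_combination -hrel)
      exact absurd this.2.2 hm0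
    · rw [hEn, hEs] at hrel
      have := hli (n * e ^ 2 - m) (2 * n * e) n (by
        simp only [map_sub, map_mul, map_pow, map_ofNat]; linear_combination hrel)
      exact absurd this.2.2 hn0
    · rw [hEs, hEs] at hrel
      have := hli (n * e ^ 2 - m * e' ^ 2) (2 * n * e - 2 * m * e') (n - m) (by
        simp only [map_sub, map_mul, map_pow, map_ofNat]; linear_combination hrel)
      obtain ⟨-, h1, h0⟩ := this
      have hnm : n = m := sub_eq_zero.1 h0
      subst hnm
      have : (2 * n) * e = (2 * n) * e' := sub_eq_zero.1 h1
      rw [mul_left_cancel₀ (mul_ne_zero h2 hn0) this]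
  · intro c hcard _ hR i j k hi hj hk
    obtain ⟨Q, hQ⟩ : ∃ Q : L → L → L → L, Q = fun a b d =>
      algebraMap K L (c 0) * (a * a) + algebraMap K L (c 1) * (b * b) +
      algebraMap K L (c 2) * (d * d) + algebraMap K L (c 3) * (a * b)
      + algebraMap K L (c 4) * (a * d) + algebraMap K L (c 5) * (b * d) := ⟨_, rfl⟩
    have hQσ : ∀ a b d, σ (Q a b d) = Q (σ a) (σ b) (σ d) := by
      intro a b d; simp [hQ]
    have hQx : Q (-(y * z)) (y + z) (-1) = 0 := by
      have : Q (algebraMap K L t₁ + algebraMap K L t₂ * x - x ^ 2) (algebraMap K L t₂ - x) (-1)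
          = 0 := by
        rw [hQ]; simpa [RvanishL, conicEval] using hR
      rw [v1, v2] at this
      convert this using 2 <;> ring
    have hQy : Q (-(x * z)) (x + z) (-1) = 0 := by
      have := congrArg σ hQx
      rw [hQσ] at this
      simp only [map_neg, map_mul, map_add, map_one, map_zero, hzx, ← hz] at this
      convert this using 2 <;> ring
    have hQz : Q (-(x * y)) (x + y) (-1) = 0 := by
      have := congrArg σ hQy
      rw [hQσ] at this
      simp only [map_neg, map_mul, map_add, map_one, map_zero, hzx, ← hy] at this
      convert this using 2 <;> ring
    obtain ⟨p, r, s, hprs⟩ := form_adapted hτσ hxz hyz _ _ _ _ _ _ Q hQ hQx hQy hQz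
    have hev : ∀ l : L, algebraMap K L (conicEval K K c (fun i => B.repr l i)) =
        p * (l * σ l) + r * (l * σ (σ l)) + s * (σ l * σ (σ l)) := by
      intro l
      have e0 := hdecomp l
      have e1 := congrArg σ e0
      simp only [map_add, map_mul, map_pow, AlgHom.commutes, ← hy] at e1
      have e2 := congrArg σ e1
      simp only [map_add, map_mul, map_pow, AlgHom.commutes, ← hz] at e2
      have := hprs (algebraMap K L (B.repr l 0)) (algebraMap K L (B.repr l 1))
        (algebraMap K L (B.repr l 2))
      rw [← e0, ← e1, ← e2] at this
      rw [← this, hQ]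
      simp [conicEval]
    have hmem : ∀ i, Projectivization.mk K (Dvec i) (hD0 i) ∈ conicZeroSet K L B c →
        (p * x * y) * σ (σ (E i)) + (r * x * z) * σ (E i) + (s * y * z) * E i = 0 := by
      intro i hi
      obtain ⟨a, ha⟩ := Projectivization.exists_smul_eq_mk_rep K (Dvec i) (hD0 i)
      have h0 := hev (Projectivization.mk K (Dvec i) (hD0 i)).rep
      rw [show conicEval K K c _ = 0 from hi, map_zero, ← ha] at h0
      obtain ⟨n, hn0, hn⟩ := hDE' i a
      generalize a • Dvec i = l at *
      have hn1 := congrArg σ hn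
      simp only [map_mul, AlgHom.commutes, ← hy] at hn1
      have hn2 := congrArg σ hn1
      simp only [map_mul, AlgHom.commutes, ← hz] at hn2
      have hnL : algebraMap K L n ≠ 0 := by simpa using hn0
      have : (algebraMap K L n) ^ 2 * ((p * x * y) * σ (σ (E i)) + (r * x * z) * σ (E i)
          + (s * y * z) * E i) = 0 := by
        have A1 : (l * E i) * (σ l * σ (E i)) = (algebraMap K L n * x) * (algebraMap K L n * y) := by
          rw [hn, hn1]
        have A2 : (l * E i) * (σ (σ l) * σ (σ (E i)))
            = (algebraMap K L n * x) * (algebraMap K L n * z) := by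
          rw [hn, hn2]
        have A3 : (σ l * σ (E i)) * (σ (σ l) * σ (σ (E i)))
            = (algebraMap K L n * y) * (algebraMap K L n * z) := by
          rw [hn1, hn2]
        linear_combination (-(p * σ (σ (E i)))) * A1 - (r * σ (E i)) * A2 - (s * E i) * A3
          - (E i * σ (E i) * σ (σ (E i))) * h0
      exact (mul_eq_zero.1 this).resolve_left (pow_ne_zero _ hnL)
    generalize hP : p * x * y = P at hmem
    generalize hRR : r * x * z = R at hmem
    generalize hS : s * y * z = S at hmem
    have hnone : Projectivization.mk K (Dvec none) (hD0 none) ∈ conicZeroSet K L B c →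
        P + R + S = 0 := by
      intro h
      have := hmem none h
      simpa [hEn] using this
    have hsome : ∀ e : K, Projectivization.mk K (Dvec (some e)) (hD0 (some e)) ∈
        conicZeroSet K L B c → (P + R + S) * (algebraMap K L e) ^ 2 +
        (2 * (P * z + R * y + S * x)) * algebraMap K L e +
        (P * z ^ 2 + R * y ^ 2 + S * x ^ 2) = 0 := by
      intro e h
      have := hmem (some e) h
      rw [hEs] at this
      simp only [map_pow, map_add, AlgHom.commutes, ← hy, ← hz] at this
      linear_combination this
    have hlin : ∀ e e' : K, e ≠ e' → P + R + S = 0 →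
        (P + R + S) * (algebraMap K L e) ^ 2 +
        (2 * (P * z + R * y + S * x)) * algebraMap K L e +
        (P * z ^ 2 + R * y ^ 2 + S * x ^ 2) = 0 →
        (P + R + S) * (algebraMap K L e') ^ 2 +
        (2 * (P * z + R * y + S * x)) * algebraMap K L e' +
        (P * z ^ 2 + R * y ^ 2 + S * x ^ 2) = 0 → P + R + S = 0 ∧
        2 * (P * z + R * y + S * x) = 0 ∧ P * z ^ 2 + R * y ^ 2 + S * x ^ 2 = 0 := by
      intro e e' hee h0 h1 h1'
      rw [h0] at h1 h1'
      have hne : algebraMap K L e - algebraMap K L e' ≠ 0 := sub_ne_zero.2 (hinj.ne hee)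
      have hm : 2 * (P * z + R * y + S * x) = 0 := by
        have : 2 * (P * z + R * y + S * x) * (algebraMap K L e - algebraMap K L e') = 0 := by
          linear_combination h1 - h1'
        exact (mul_eq_zero.1 this).resolve_right hne
      rw [hm] at h1
      exact ⟨h0, hm, by linear_combination h1⟩
    by_contra hcon
    push Not at hcon
    obtain ⟨hij, hik, hjk⟩ := hcon
    have hall : P + R + S = 0 ∧
        2 * (P * z + R * y + S * x) = 0 ∧ P * z ^ 2 + R * y ^ 2 + S * x ^ 2 = 0 := by
      rcases i with _ | i <;> rcases j with _ | j <;> rcases k with _ | k <;>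
        first
        | exact absurd rfl hij
        | exact absurd rfl hik
        | exact absurd rfl hjk
        | skip
      · exact hlin j k (fun h => hjk (by rw [h])) (hnone hi) (hsome j hj) (hsome k hk)
      · exact hlin i k (fun h => hik (by rw [h])) (hnone hj) (hsome i hi) (hsome k hk)
      · exact hlin i j (fun h => hij (by rw [h])) (hnone hk) (hsome i hi) (hsome j hj)
      · exact quad_zero (hinj.ne fun h => hij (by rw [h])) (hinj.ne fun h => hik (by rw [h]))
          (hinj.ne fun h => hjk (by rw [h])) (hsome i hi) (hsome j hj) (hsome k hk)
    obtain ⟨w0, w1, w2⟩ := hall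
    obtain ⟨u1, u2, u3⟩ := vdm_zero hτσ hxz hyz w0 ((mul_eq_zero.1 w1).resolve_left h2L) w2
    have hp : p = 0 := by rw [u1] at hP; simpa [hx0, hy0] using hP
    have hr : r = 0 := by rw [u2] at hRR; simpa [hx0, hz0] using hRR
    have hs : s = 0 := by rw [u3] at hS; simpa [hy0, hz0] using hS
    have huniv : conicZeroSet K L B c = Set.univ := by
      ext T
      simp only [conicZeroSet, Set.mem_ofPred_eq, Set.mem_univ, iff_true]
      apply hinj
      rw [hev, hp, hr, hs]; simp
    rw [huniv, Set.ncard_univ] at hcard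
    have hc := Projectivization.card K L
    rw [hcard, hcardL, Nat.card_eq_fintype_card, hK] at hc
    obtain ⟨m, rfl⟩ : ∃ m, q = m + 1 := ⟨q - 1, by omega⟩
    have : (m + 1) ^ 3 = (m + 1 + 1) * m + 1 := by
      have : (m + 1) ^ 3 ≥ 1 := Nat.one_le_pow _ _ (by omega)
      simp at hc
      lia
    nlinarith [sq_nonneg m]

end
end

section
/- For a ∈ K define f(a) := 1 + a·t₂ − a²·t₁ + a·τ + a²·τ² ∈ L. The q+1 points [f(a)] (a ∈ K) and [−t₁+τ²] of ℙ_K(L) are pairwise distinct and are exactly the zero set of the quadratic form y₁² − t₁y₂² + t₂y₁y₂ − y₀y₂ in the coordinates (y₀,y₁,y₂); this zero set is a nondegenerate conic. Moreover this form, evaluated over L, vanishes at the transversal vector R = (t₁+t₂τ−τ², t₂−τ, −1); hence these q+1 points form a special conic of ℙ_K(L). -/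
open scoped LinearAlgebra.Projectivization
open Module

noncomputable section

/-- with f(a) := 1 + a·t₂ − a²·t₁ + a·τ + a²·τ², the q+1 points [f(a)] (a ∈ K)
and [−t₁+τ²] of ℙ_K(L) are pairwise distinct and are exactly the zero set of the quadratic
form y₁² − t₁y₂² + t₂y₁y₂ − y₀y₂, which is a nondegenerate conic; moreover the form vanishes
(over L) at the transversal vector R, so these points form a special conic. -/
theorem tangent_splash_stmt_16
    (q : ℕ) (K L : Type) [Field K] [Field L] [Algebra K L] [Fintype K]
    (hK : Fintype.card K = q)
    (τ : L) (t₀ t₁ t₂ : K)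
    (B : Basis (Fin 3) K L) (hB0 : B 0 = 1) (hB1 : B 1 = τ) (hB2 : B 2 = τ ^ 2)
    (hτ3 : τ ^ 3 = algebraMap K L t₂ * τ ^ 2 + algebraMap K L t₁ * τ + algebraMap K L t₀)
    (hprim : ∀ x : L, x ≠ 0 → ∃ n : ℕ, τ ^ n = x)
    -- the vectors representing the points [f(a)] (a ∈ K) and [−t₁+τ²] (index `none`)
    (Uvec : Option K → L)
    (hUa : ∀ a : K, Uvec (some a) =
      algebraMap K L (1 + a * t₂ - a ^ 2 * t₁) + algebraMap K L a * τ +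
        algebraMap K L (a ^ 2) * τ ^ 2)
    (hUinf : Uvec none = -algebraMap K L t₁ + τ ^ 2)
    (hU0 : ∀ i : Option K, Uvec i ≠ 0) :
    -- the q+1 points are pairwise distinct
    Function.Injective (fun i : Option K => Projectivization.mk K (Uvec i) (hU0 i)) ∧
    -- they are exactly the zero set of the form y₁² − t₁y₂² + t₂y₁y₂ − y₀y₂
    Set.range (fun i : Option K => Projectivization.mk K (Uvec i) (hU0 i)) =
      conicZeroSet K L B ![0, 1, -t₁, 0, -1, t₂] ∧
    -- this zero set is a nondegenerate conic: q+1 points, no three collinear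
    (conicZeroSet K L B ![0, 1, -t₁, 0, -1, t₂]).ncard = q + 1 ∧
    NoThreeCollinear K L (conicZeroSet K L B ![0, 1, -t₁, 0, -1, t₂]) ∧
    -- the form, evaluated over L, vanishes at the transversal vector R
    RvanishL K L τ t₀ t₁ t₂ ![0, 1, -t₁, 0, -1, t₂] ∧
    -- hence the points form a special conic of ℙ_K(L)
    IsSpecialConic q K L B τ t₀ t₁ t₂
      (Set.range (fun i : Option K => Projectivization.mk K (Uvec i) (hU0 i))) := by
  have hfun : ∀ x : L, x = algebraMap K L (B.repr x 0) + algebraMap K L (B.repr x 1) * τ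
      + algebraMap K L (B.repr x 2) * τ ^ 2 := by
    intro x
    have h := B.sum_repr x
    rw [Fin.sum_univ_three, hB0, hB1, hB2] at h
    simp only [Algebra.smul_def, mul_one] at h
    exact h.symm
  have hrepr : ∀ a b c : K, ∀ i, B.repr (algebraMap K L a + algebraMap K L b * τ
      + algebraMap K L c * τ ^ 2) i = ![a, b, c] i := by
    intro a b c i
    have h : algebraMap K L a + algebraMap K L b * τ + algebraMap K L c * τ ^ 2
        = ∑ i, (![a, b, c] i) • B i := by
      rw [Fin.sum_univ_three, hB0, hB1, hB2]
      simp [Algebra.smul_def]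
    rw [h, B.repr_sum_self]
  have hUinf' : Uvec none = algebraMap K L (-t₁) + algebraMap K L 0 * τ
      + algebraMap K L 1 * τ ^ 2 := by
    rw [hUinf]; simp
  have hinj : Function.Injective
      (fun i : Option K => Projectivization.mk K (Uvec i) (hU0 i)) := by
    intro i j hij
    obtain ⟨s, hs⟩ := (Projectivization.mk_eq_mk_iff' K _ _ (hU0 i) (hU0 j)).1 hij
    have hc : ∀ k, s * B.repr (Uvec j) k = B.repr (Uvec i) k := by
      intro k; rw [← hs]; simp
    have h0 := hc 0
    have h1 := hc 1
    have h2 := hc 2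
    rcases i with _ | a <;> rcases j with _ | b
    · rfl
    · rw [hUinf', hUa] at h0 h1 h2
      simp only [hrepr] at h0 h1 h2
      simp at h0 h1 h2
      rcases h1 with h | h <;> simp [h] at h2
    · rw [hUinf', hUa] at h0 h1 h2
      simp only [hrepr] at h0 h1 h2
      simp at h0 h1 h2
      simp [← h1] at h0 h2
      simp [h2] at h0
    · rw [hUa, hUa] at h0 h1 h2
      simp only [hrepr] at h0 h1 h2
      simp at h0 h1 h2
      have hs1 : s = 1 := by linear_combination h0 - t₂ * h1 + t₁ * h2
      rw [hs1, one_mul] at h1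
      rw [h1]
  have hmem : ∀ P : ℙ K L, P ∈ conicZeroSet K L B ![0, 1, -t₁, 0, -1, t₂] ↔
      B.repr P.rep 1 ^ 2 - t₁ * B.repr P.rep 2 ^ 2 + t₂ * (B.repr P.rep 1 * B.repr P.rep 2)
        - B.repr P.rep 0 * B.repr P.rep 2 = 0 := by
    intro P
    have : conicEval K K ![0, 1, -t₁, 0, -1, t₂] (fun i => B.repr P.rep i) =
      B.repr P.rep 1 ^ 2 - t₁ * B.repr P.rep 2 ^ 2 + t₂ * (B.repr P.rep 1 * B.repr P.rep 2)
        - B.repr P.rep 0 * B.repr P.rep 2 := by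
      simp [conicEval]; ring
    rw [← this]; rfl
  have hrange : Set.range (fun i : Option K => Projectivization.mk K (Uvec i) (hU0 i)) =
      conicZeroSet K L B ![0, 1, -t₁, 0, -1, t₂] := by
    ext P
    rw [hmem]
    constructor
    · rintro ⟨i, rfl⟩
      obtain ⟨s, hs⟩ := Projectivization.exists_smul_eq_mk_rep K (Uvec i) (hU0 i)
      have hc : ∀ k, B.repr (Projectivization.mk K (Uvec i) (hU0 i)).rep k
          = (s : K) * B.repr (Uvec i) k := by
        intro k; rw [← hs, Units.smul_def]; simp
      simp only [hc]
      rcases i with _ | a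
      · rw [hUinf']
        simp only [hrepr]
        simp
        ring
      · rw [hUa]
        simp only [hrepr]
        simp
        ring
    · intro h
      have hx := hfun P.rep
      have hne := P.rep_nonzero
      generalize B.repr P.rep 0 = y0 at h hx
      generalize B.repr P.rep 1 = y1 at h hx
      generalize B.repr P.rep 2 = y2 at h hx
      have key : ∀ i, ∀ s : K, s • Uvec i = P.rep →
          P ∈ Set.range (fun i : Option K => Projectivization.mk K (Uvec i) (hU0 i)) := by
        intro i s hs
        have hs0 : s ≠ 0 := by
          rintro rfl
          rw [zero_smul] at hs
          exact hne hs.symm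
        refine ⟨i, ?_⟩
        rw [← P.mk_rep]
        refine ((Projectivization.mk_eq_mk_iff' K _ _ _ _).2 ⟨s, hs⟩).symm
      by_cases h2 : y2 = 0
      · subst h2
        have h1 : y1 = 0 := by simpa using h
        subst h1
        apply key (some 0) y0
        rw [hUa, hx, Algebra.smul_def]; simp
      · by_cases h1 : y1 = 0
        · subst h1
          have h0 : y0 = -t₁ * y2 := by
            apply mul_right_cancel₀ h2
            linear_combination -h
          apply key none y2
          rw [hUinf, hx, Algebra.smul_def, h0]; simp; ring
        · apply key (some (y2 / y1)) (y1 ^ 2 / y2)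
          have e0 : (y1 ^ 2 / y2) * (1 + (y2 / y1) * t₂ - (y2 / y1) ^ 2 * t₁) = y0 := by
            field_simp
            linear_combination h
          have e1 : (y1 ^ 2 / y2) * (y2 / y1) = y1 := by field_simp
          have e2 : (y1 ^ 2 / y2) * (y2 / y1) ^ 2 = y2 := by field_simp
          rw [hUa, hx, Algebra.smul_def, mul_add, mul_add, ← mul_assoc, ← mul_assoc,
            ← map_mul, ← map_mul, ← map_mul, e0, e1, e2]
  have hcard : (conicZeroSet K L B ![0, 1, -t₁, 0, -1, t₂]).ncard = q + 1 := by
    rw [← hrange, ← Set.image_univ, Set.ncard_image_of_injective _ hinj, Set.ncard_univ,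
      Nat.card_eq_fintype_card, Fintype.card_option, hK]
  have hno : NoThreeCollinear K L (conicZeroSet K L B ![0, 1, -t₁, 0, -1, t₂]) := by
    rw [← hrange]
    rintro _ _ _ ⟨i, rfl⟩ ⟨j, rfl⟩ ⟨k, rfl⟩ hij hik hjk W hW ⟨hi, hj, hk⟩
    have hij : i ≠ j := fun h => hij (by rw [h])
    have hik : i ≠ k := fun h => hik (by rw [h])
    have hjk : j ≠ k := fun h => hjk (by rw [h])
    simp only [Projectivization.submodule_mk, Submodule.span_singleton_le_iff_mem] at hi hj hk
    have hlt : W < ⊤ := by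
      rw [lt_top_iff_ne_top]
      rintro rfl
      rw [finrank_top, Module.finrank_eq_card_basis B] at hW
      simp at hW
    obtain ⟨φ, hφ0, hφ⟩ := Submodule.exists_le_ker_of_lt_top W hlt
    have hφi : φ (Uvec i) = 0 := hφ hi
    have hφj : φ (Uvec j) = 0 := hφ hj
    have hφk : φ (Uvec k) = 0 := hφ hk
    obtain ⟨u, hu⟩ : ∃ u, u = φ 1 := ⟨_, rfl⟩
    obtain ⟨v, hv⟩ : ∃ v, v = φ τ + t₂ * φ 1 := ⟨_, rfl⟩
    obtain ⟨w, hw⟩ : ∃ w, w = φ (τ ^ 2) - t₁ * φ 1 := ⟨_, rfl⟩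
    have hs : ∀ a, φ (Uvec (some a)) = u + v * a + w * a ^ 2 := by
      intro a
      rw [hUa, Algebra.algebraMap_eq_smul_one, ← Algebra.smul_def, ← Algebra.smul_def]
      simp only [map_add, map_smul, smul_eq_mul]
      rw [hu, hv, hw]; ring
    have hn : φ (Uvec none) = w := by
      rw [hUinf, Algebra.algebraMap_eq_smul_one]
      simp only [map_add, map_neg, map_smul, smul_eq_mul]
      rw [hw]; ring
    have two : ∀ a b : K, a ≠ b → u + v * a + w * a ^ 2 = 0 → u + v * b + w * b ^ 2 = 0 →
        v + w * (a + b) = 0 := by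
      intro a b hab ha hb
      apply mul_left_cancel₀ (sub_ne_zero.2 hab)
      linear_combination ha - hb
    have fin2 : ∀ a b : K, a ≠ b → u + v * a + w * a ^ 2 = 0 → u + v * b + w * b ^ 2 = 0 →
        w = 0 → u = 0 ∧ v = 0 ∧ w = 0 := by
      intro a b hab ha hb hw0
      have hv0 := two a b hab ha hb
      rw [hw0] at hv0 ha
      have hv0 : v = 0 := by simpa using hv0
      rw [hv0] at ha
      exact ⟨by simpa using ha, hv0, hw0⟩
    have hz : u = 0 ∧ v = 0 ∧ w = 0 := by
      rcases i with _ | a <;> rcases j with _ | b <;> rcases k with _ | c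
      · exact absurd rfl hij
      · exact absurd rfl hij
      · exact absurd rfl hik
      · rw [hs] at hφj hφk
        rw [hn] at hφi
        exact fin2 b c (fun h => hjk (by rw [h])) hφj hφk hφi
      · exact absurd rfl hjk
      · rw [hs] at hφi hφk
        rw [hn] at hφj
        exact fin2 a c (fun h => hik (by rw [h])) hφi hφk hφj
      · rw [hs] at hφi hφj
        rw [hn] at hφk
        exact fin2 a b (fun h => hij (by rw [h])) hφi hφj hφk
      · rw [hs] at hφi hφj hφk
        have hab : a ≠ b := fun h => hij (by rw [h])
        have hac : a ≠ c := fun h => hik (by rw [h])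
        have hbc : b ≠ c := fun h => hjk (by rw [h])
        refine fin2 a b hab hφi hφj ?_
        have e1 := two a b hab hφi hφj
        have e2 := two a c hac hφi hφk
        apply mul_left_cancel₀ (sub_ne_zero.2 hbc)
        linear_combination e1 - e2
    obtain ⟨hu0, hv0, hw0⟩ := hz
    rw [hu0] at hu
    rw [hv0, ← hu] at hv
    rw [hw0, ← hu] at hw
    apply hφ0
    apply B.ext
    intro m
    fin_cases m
    · simpa [hB0] using hu.symm
    · simpa [hB1] using hv.symm
    · simpa [hB2] using hw.symm
  have hR : RvanishL K L τ t₀ t₁ t₂ ![0, 1, -t₁, 0, -1, t₂] := by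
    simp [RvanishL, conicEval]; ring
  refine ⟨hinj, hrange, hcard, hno, hR, _, hrange, ?_, ?_, hR⟩
  · rw [hrange]; exact hcard
  · rw [hrange]; exact hno

end
end
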